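/- arXiv:2410.23490 — 2 statements merged into one kernel-verified Lean document; each statement's English description precedes it below -/
import Mathlib

section
/- Let (M,η,H) be a contact Hamiltonian system and Y a vector field on M with Hamiltonian–horizontal decomposition Y = X_{φ_Y} + δ_Y (φ_Y = −η(Y), δ_Y horizontal). Then Y is a dynamical symmetry of the system, i.e. η([Y, X_H]) = 0, if and only if {φ_Y, H}_η = 0. -/
open scoped BigOperators

/-- Vector fields on the "manifold" whose algebra of smooth functions is `R`,
modeled as ℝ-linear derivations of `R`. -/
abbrev VectorFieldOn (R : Type*) [CommRing R] [Algebra ℝ R] : Type _ := Derivation ℝ R R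

/-- The exterior derivative of a 1-form (an `R`-linear functional on vector fields),
via the intrinsic (Koszul) formula `dη(X,Y) = X(η(Y)) - Y(η(X)) - η([X,Y])`. -/
def dForm {R : Type*} [CommRing R] [Algebra ℝ R]
    (η : VectorFieldOn R →ₗ[R] R) (X Y : VectorFieldOn R) : R :=
  X (η Y) - Y (η X) - η ⁅X, Y⁆

/-- An exact contact manifold of dimension `2n+1`, described through its algebra of
smooth functions `R`: a contact form `eta`, nondegenerate and of maximal rank, with
its Reeb vector field and the contact Hamiltonian vector field assignment `ham`,
each characterized by the usual defining equations (together with uniqueness, which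
is what the contact condition `η ∧ (dη)^n ≠ 0` grants). -/
structure ExactContact (R : Type*) [CommRing R] [Algebra ℝ R] where
  n : ℕ
  eta : VectorFieldOn R →ₗ[R] R
  nondeg : ∀ Z : VectorFieldOn R, eta Z = 0 → (∀ Y, dForm eta Z Y = 0) → Z = 0
  dim_le : ∀ ω : AlternatingMap R (VectorFieldOn R) R (Fin (2 * n + 2)), ω = 0
  reeb : VectorFieldOn R
  reeb_eta : eta reeb = 1
  reeb_dEta : ∀ Y, dForm eta reeb Y = 0
  reeb_unique : ∀ Z, eta Z = 1 → (∀ Y, dForm eta Z Y = 0) → Z = reeb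
  ham : R → VectorFieldOn R
  ham_eta : ∀ f, eta (ham f) = -f
  ham_dEta : ∀ f Y, dForm eta (ham f) Y = Y f - reeb f * eta Y
  ham_unique : ∀ f Z, eta Z = -f → (∀ Y, dForm eta Z Y = Y f - reeb f * eta Y) → Z = ham f

/-- The Jacobi bracket induced by the contact form: `{f,g}_η = X_f(g) + g R(f)`. -/
def ExactContact.jacobi {R : Type*} [CommRing R] [Algebra ℝ R]
    (C : ExactContact R) (f g : R) : R :=
  C.ham f g + g * C.reeb f

theorem dForm_swap {R : Type*} [CommRing R] [Algebra ℝ R]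
    (η : VectorFieldOn R →ₗ[R] R) (X Y : VectorFieldOn R) :
    dForm η X Y = -dForm η Y X := by
  simp only [dForm, ← lie_skew X Y, map_neg]
  ring

namespace ExactContact

variable {R : Type*} [CommRing R] [Algebra ℝ R] (C : ExactContact R)

/-- The Jacobi bracket is antisymmetric. -/
theorem jacobi_swap (f g : R) : C.jacobi f g = -C.jacobi g f := by
  have h := dForm_swap C.eta (C.ham f) (C.ham g)
  rw [C.ham_dEta, C.ham_dEta, C.ham_eta, C.ham_eta] at h
  simp only [jacobi]
  linear_combination h

theorem eta_lie_ham (H : R) (Y : VectorFieldOn R) :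
    C.eta ⁅Y, C.ham H⁆ = C.jacobi H (-C.eta Y) := by
  have h := C.ham_dEta H Y
  rw [dForm, C.ham_eta, map_neg, ← lie_skew, map_neg] at h
  rw [jacobi, map_neg]
  linear_combination h

end ExactContact

/-- `Y` is a dynamical symmetry of `(M,η,H)`, i.e. `η([Y,X_H]) = 0`,
iff `{φ_Y, H}_η = 0` where `φ_Y = -η(Y)` is its Hamiltonian part. -/
theorem dynamical_symmetry_iff {R : Type*} [CommRing R] [Algebra ℝ R]
    (C : ExactContact R) (H : R) (Y : VectorFieldOn R) :
    C.eta ⁅Y, C.ham H⁆ = 0 ↔ C.jacobi (-C.eta Y) H = 0 := by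
  rw [C.eta_lie_ham, C.jacobi_swap, neg_eq_zero]
end

section
/- Let (M,η,H) be a contact Hamiltonian system and Y a scaling symmetry, i.e. [Y, X_H] = λ X_H for a constant λ ∈ ℝ. Write Y = X_{φ_Y} + δ_Y for its Hamiltonian–horizontal decomposition with φ_Y = −η(Y). Then the horizontal part commutes with the Hamiltonian flow: [δ_Y, X_H] = 0. -/
open scoped BigOperators

namespace ExactContact

variable {R : Type*} [CommRing R] [Algebra ℝ R] (C : ExactContact R)

/-- Contact Hamiltonian vector fields rescale the contact form: `L_{X_f} η = -R(f) η`. -/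
theorem eta_lie_ham_s9 (f : R) (Z : VectorFieldOn R) :
    C.eta ⁅C.ham f, Z⁆ = C.ham f (C.eta Z) + C.reeb f * C.eta Z := by
  have h := C.ham_dEta f Z
  simp only [dForm, C.ham_eta, map_neg] at h
  linear_combination -h

/-- The commutator of two contact Hamiltonian vector fields rescales the contact form. -/
theorem eta_lie_lie_ham (f g : R) (Z : VectorFieldOn R) :
    C.eta ⁅⁅C.ham f, C.ham g⁆, Z⁆ = ⁅C.ham f, C.ham g⁆ (C.eta Z) +
      (C.ham f (C.reeb g) - C.ham g (C.reeb f)) * C.eta Z := by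
  rw [lie_lie, map_sub]
  simp only [eta_lie_ham_s9, Derivation.commutator_apply, map_add, Derivation.leibniz, smul_eq_mul]
  ring

/-- A horizontal vector field that rescales the contact form vanishes. -/
theorem eq_zero_of_eta_eq_zero_of_eta_lie (ρ : R) (D : VectorFieldOn R) (hD : C.eta D = 0)
    (h : ∀ Z, C.eta ⁅D, Z⁆ = D (C.eta Z) + ρ * C.eta Z) : D = 0 := by
  have hρ : ρ = 0 := by
    have h₁ := C.reeb_dEta D
    have h₂ := h C.reeb
    rw [← lie_skew, map_neg] at h₂
    simp only [dForm, C.reeb_eta, hD, map_zero, Derivation.map_one_eq_zero] at h₁ h₂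
    linear_combination h₁ - h₂
  refine C.nondeg D hD fun Z => ?_
  rw [dForm, h, hD, hρ, map_zero]
  ring

end ExactContact

/-- if `Y` is a scaling symmetry, `[Y, X_H] = λ X_H` with `λ ∈ ℝ`
constant, then the horizontal part `δ_Y = Y - X_{φ_Y}` of its Hamiltonian–horizontal
decomposition commutes with the Hamiltonian flow: `[δ_Y, X_H] = 0`. -/
theorem scaling_symmetry_horizontal_commutes {R : Type*} [CommRing R] [Algebra ℝ R]
    (C : ExactContact R) (H : R) (Y : VectorFieldOn R) (lam : ℝ)
    (hY : ⁅Y, C.ham H⁆ = lam • C.ham H) :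
    ⁅Y - C.ham (-C.eta Y), C.ham H⁆ = 0 := by
  have hδ : C.eta (Y - C.ham (-C.eta Y)) = 0 := by
    rw [map_sub, C.ham_eta]
    ring
  have hD : ⁅Y - C.ham (-C.eta Y), C.ham H⁆ = lam • C.ham H - ⁅C.ham (-C.eta Y), C.ham H⁆ := by
    rw [sub_lie, hY]
  refine C.eq_zero_of_eta_eq_zero_of_eta_lie (algebraMap ℝ R lam * C.reeb H -
    (C.ham (-C.eta Y) (C.reeb H) - C.ham H (C.reeb (-C.eta Y)))) _ ?_ fun Z => ?_
  · rw [← lie_skew, map_neg, C.eta_lie_ham_s9, hδ, map_zero]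
    ring
  · have hs : lam • C.ham H = algebraMap ℝ R lam • C.ham H := (algebraMap_smul R lam _).symm
    rw [hD, sub_lie, map_sub, C.eta_lie_lie_ham, smul_lie, ← algebraMap_smul R lam ⁅C.ham H, Z⁆,
      hs, map_smul, C.eta_lie_ham_s9]
    simp only [Derivation.sub_apply, Derivation.smul_apply, smul_eq_mul]
    ring
end
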